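/- Let M be a deterministic finite automaton over a finite alphabet Γ with finite state set S. If states s and s' are each reachable from the other, then limsup_{N→∞} (f_s(N))^{1/N} = limsup_{N→∞} (f_{s'}(N))^{1/N}, where the limsup is taken over real N-th roots. -/

import Mathlib

open Filter

/-- The number of words of length `N` over `Γ` which, when read by `M` starting from
state `s`, end in an accept state. -/
noncomputable def acceptCount {Γ S : Type*} (M : DFA Γ S) (s : S) (N : ℕ) : ℕ :=
  Nat.card {w : List Γ // w.length = N ∧ M.evalFrom s w ∈ M.accept}

/-- `s'` is reachable from `s`: some (possibly empty) sequence of transitions leads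
from `s` to `s'`. -/
def ReachableFrom {Γ S : Type*} (M : DFA Γ S) (s s' : S) : Prop :=
  ∃ w : List Γ, M.evalFrom s w = s'

lemma limsup_root_le (f g : ℕ → ℕ) (C k : ℕ) (hf : ∀ N, f N ≤ C ^ N)
    (hg : ∀ N, g N ≤ f (N + k)) :
    limsup (fun N : ℕ => (g N : ℝ) ^ (1 / (N : ℝ))) atTop ≤
      limsup (fun N : ℕ => (f N : ℝ) ^ (1 / (N : ℝ))) atTop := by
  have hbdd : IsBoundedUnder (· ≤ ·) atTop (fun N : ℕ => (f N : ℝ) ^ (1 / (N : ℝ))) := by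
    refine isBoundedUnder_of_eventually_le (a := (C : ℝ)) ?_
    filter_upwards [eventually_ge_atTop 1] with N hN
    have hN' : N ≠ 0 := by omega
    calc (f N : ℝ) ^ (1 / (N : ℝ)) ≤ ((C : ℝ) ^ N) ^ (1 / (N : ℝ)) := by
          apply Real.rpow_le_rpow (by positivity) _ (by positivity)
          exact_mod_cast hf N
      _ = C := by
          rw [one_div]
          exact Real.pow_rpow_inv_natCast (by positivity) hN'
  have hL : 0 ≤ limsup (fun N : ℕ => (f N : ℝ) ^ (1 / (N : ℝ))) atTop :=
    le_limsup_of_frequently_le (Frequently.of_forall fun N => by positivity) hbdd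
  refine le_of_forall_gt_imp_ge_of_dense fun b hb => ?_
  have hb0 : 0 < b := lt_of_le_of_lt hL hb
  have hev := eventually_lt_of_limsup_lt hb hbdd
  have hlim : Tendsto (fun N : ℕ => b * b ^ ((k : ℝ) / (N : ℝ))) atTop (nhds b) := by
    have h0 : Tendsto (fun N : ℕ => (k : ℝ) / (N : ℝ)) atTop (nhds 0) :=
      tendsto_const_div_atTop_nhds_zero_nat _
    have h1 := ((Real.continuousAt_const_rpow (b := 0) hb0.ne').tendsto.comp h0).const_mul b
    simpa using h1
  rw [← hlim.limsup_eq]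
  refine limsup_le_limsup ?_ ?_ hlim.isBoundedUnder_le
  · filter_upwards [eventually_ge_atTop 1, (tendsto_add_atTop_nat k).eventually hev] with N hN h
    have hN0 : (N : ℝ) ≠ 0 := by
      have : N ≠ 0 := by omega
      exact_mod_cast this
    have hNk : N + k ≠ 0 := by omega
    have h2 : (f (N + k) : ℝ) ≤ b ^ (N + k) := by
      have := pow_le_pow_left₀ (by positivity) h.le (N + k)
      rwa [one_div, Real.rpow_inv_natCast_pow (by positivity) hNk] at this
    have h3 : (g N : ℝ) ≤ b ^ (N + k) := le_trans (by exact_mod_cast hg N) h2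
    calc (g N : ℝ) ^ (1 / (N : ℝ)) ≤ (b ^ (N + k)) ^ (1 / (N : ℝ)) :=
          Real.rpow_le_rpow (by positivity) h3 (by positivity)
      _ = b * b ^ ((k : ℝ) / (N : ℝ)) := by
          rw [← Real.rpow_natCast, ← Real.rpow_mul hb0.le]
          nth_rewrite 2 [← Real.rpow_one b]
          rw [← Real.rpow_add hb0]
          congr 1
          push_cast
          field_simp
  · exact IsBoundedUnder.isCoboundedUnder_le
      (isBoundedUnder_of_eventually_ge (a := 0) (Eventually.of_forall fun N => by positivity))

lemma finite_words {Γ S : Type} [Fintype Γ] (M : DFA Γ S) (s : S) (N : ℕ) :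
    Finite {w : List Γ // w.length = N ∧ M.evalFrom s w ∈ M.accept} :=
  Finite.of_injective (β := List.Vector Γ N) (fun w => ⟨w.1, w.2.1⟩) fun a b h =>
    Subtype.ext (congrArg (fun v : List.Vector Γ N => v.1) h)

lemma acceptCount_le_pow {Γ S : Type} [Fintype Γ] (M : DFA Γ S) (s : S) (N : ℕ) :
    acceptCount M s N ≤ Fintype.card Γ ^ N := by
  rw [← card_vector, ← Nat.card_eq_fintype_card]
  exact Nat.card_le_card_of_injective (β := List.Vector Γ N) (fun w => ⟨w.1, w.2.1⟩) fun a b h =>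
    Subtype.ext (congrArg (fun v : List.Vector Γ N => v.1) h)

lemma acceptCount_le_shift {Γ S : Type} [Fintype Γ] (M : DFA Γ S) (s : S) (u : List Γ) (N : ℕ) :
    acceptCount M (M.evalFrom s u) N ≤ acceptCount M s (N + u.length) := by
  haveI := finite_words M s (N + u.length)
  refine Nat.card_le_card_of_injective
    (fun w => ⟨u ++ w.1, by simp [w.2.1, add_comm], by
      rw [DFA.evalFrom_of_append]; exact w.2.2⟩) fun a b h => ?_
  exact Subtype.ext (List.append_cancel_left (congrArg Subtype.val h))

/-- If two states of a DFA over a finite alphabet are each reachable from the other, then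
the growth rates (limsup of `N`-th roots of the accepted-word counts) from the two states
coincide. -/
theorem growth_constant_on_scc {Γ S : Type} [Fintype Γ] [Fintype S] (M : DFA Γ S)
    (s s' : S) (h1 : ReachableFrom M s s') (h2 : ReachableFrom M s' s) :
    limsup (fun N : ℕ => (acceptCount M s N : ℝ) ^ (1 / (N : ℝ))) atTop =
      limsup (fun N : ℕ => (acceptCount M s' N : ℝ) ^ (1 / (N : ℝ))) atTop := by
  obtain ⟨u, rfl⟩ := h1
  obtain ⟨v, hv⟩ := h2
  apply le_antisymm
  · refine limsup_root_le _ _ (Fintype.card Γ) v.length (acceptCount_le_pow M _) fun N => ?_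
    have := acceptCount_le_shift M (M.evalFrom s u) v N
    rwa [hv] at this
  · exact limsup_root_le _ _ (Fintype.card Γ) u.length (acceptCount_le_pow M _)
      (acceptCount_le_shift M s u)
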